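/- arXiv:2502.03562 — 2 statements merged into one kernel-verified Lean document; each statement's English description precedes it below -/
import Mathlib

section
/- Let p be a prime. Fix integers n ≥ 2, 2 ≤ r ≤ n−1, and K_0, K_1, …, K_r ∈ ℤ_{≥0} with K_0 ≥ K_1 + K_2 + ⋯ + K_r, K_1 ≥ 1, and K_2 ≥ 1. Then (𝒜_p(K_0, K_1, K_2, …, K_r) − 𝒜_p(K_0+1, K_1−1, K_2, …, K_r)) − (𝒜_p(K_0+1, K_1+1, K_2−1, …, K_r) − 𝒜_p(K_0+2, K_1, K_2−1, …, K_r)) = Σ_{k_3=0}^{K_3} ⋯ Σ_{k_r=0}^{K_r} A(p^{K_0−K_1−K_2−k_3−⋯−k_r}, p^{K_1}, p^{K_3+K_2−k_3}, …, p^{K_r+k_{r−1}−k_r}, p^{k_r}, 1, …, 1). -/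
/-- The tuple `(m, 1, …, 1)` of length `n - 1`. -/
def E (n m : ℕ) : Fin (n - 1) → ℕ := fun i => if i.val = 0 then m else 1

/-- The Hecke relation satisfied by the Fourier coefficients `A` of a Hecke–Maass form
for `SL(n, ℤ)`:  for all positive integers `m, m₁, …, m_{n-1}`,
`A(m,1,…,1)·A(m₁,…,m_{n-1}) = Σ A(m₁cₙ/c₁, m₂c₁/c₂, …, m_{n-1}c_{n-2}/c_{n-1})`,
the sum over tuples `(c₁,…,cₙ)` of positive integers with `c₁⋯cₙ = m` and `cᵢ ∣ mᵢ`
for `1 ≤ i ≤ n-1`.  (Here the tuple `(c₁,…,c_{n-1})` is parametrized by divisors of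
the `mᵢ` whose product divides `m`, and `cₙ = m / (c₁⋯c_{n-1})`.) -/
def HeckeRel (n : ℕ) (A : (Fin (n - 1) → ℕ) → ℂ) : Prop :=
  ∀ m : ℕ, 0 < m → ∀ M : Fin (n - 1) → ℕ, (∀ i, 0 < M i) →
    A (E n m) * A M =
      ∑ c ∈ Finset.filter (fun c : Fin (n - 1) → ℕ => (∏ i, c i) ∣ m)
          (Fintype.piFinset fun i => (M i).divisors),
        A (fun i => M i *
            (if i.val = 0 then m / ∏ j, c j else c ⟨i.val - 1, by have := i.isLt; omega⟩)
            / c i)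

/-- The tuple `(p^{K₁}, …, p^{K_r}, 1, …, 1)` of length `n - 1`, with the prime powers
in the first `r` coordinates (here `K j` plays the role of `K_j`). -/
def pcoef (n r p : ℕ) (K : ℕ → ℕ) : Fin (n - 1) → ℕ :=
  fun i => if i.val < r then p ^ K (i.val + 1) else 1

/-- The tuple
`(p^L, p^{K₂+k₁-k₂}, p^{K₃+k₂-k₃}, …, p^{K_r+k_{r-1}-k_r}, p^{k_r}, 1, …, 1)`
of length `n - 1`, where `L = K₀ + K₁ - 2k₁ - k₂ - ⋯ - k_r`, appearing in Lemma 2.2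
(here `k ⟨t-1,_⟩` plays the role of `k_t`, and `K j` of `K_j`). -/
def tup (n r p : ℕ) (hr : 0 < r) (K : ℕ → ℕ) (k : Fin r → ℕ) : Fin (n - 1) → ℕ :=
  fun i =>
    if i.val = 0 then p ^ (K 0 + K 1 - (k ⟨0, hr⟩ + ∑ j, k j))
    else if h : i.val < r then
      p ^ (K (i.val + 1) + k ⟨i.val - 1, by omega⟩ - k ⟨i.val, h⟩)
    else if i.val = r then p ^ k ⟨r - 1, by omega⟩
    else 1

theorem aux_prod (N r p : ℕ) (h : r ≤ N) (k : Fin r → ℕ) :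
    (∏ i : Fin N, (if h : i.val < r then p ^ k ⟨i.val, h⟩ else 1)) = p ^ ∑ j, k j := by
  obtain ⟨t, rfl⟩ := Nat.exists_eq_add_of_le h
  rw [Fin.prod_univ_add]
  simp [Finset.prod_pow_eq_pow_sum]

theorem aux_hecke (n : ℕ) (A : (Fin (n - 1) → ℕ) → ℂ) (hA : HeckeRel n A)
    (p : ℕ) (hp : p.Prime) (r : ℕ) (hr : 0 < r) (hrn : r ≤ n - 1)
    (K : ℕ → ℕ) (hK : ∑ j : Fin r, K (j.val + 1) ≤ K 0) :
    A (E n (p ^ K 0)) * A (pcoef n r p K) =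
      ∑ k ∈ Fintype.piFinset (fun t : Fin r => Finset.range (K (t.val + 1) + 1)),
        A (tup n r p hr K k) := by
  have hpp := hp.pos
  rw [hA _ (pow_pos hpp _) _ (by intro i; unfold pcoef; split_ifs <;> positivity)]
  symm
  refine Finset.sum_bij
    (fun k _ => fun i => if h : i.val < r then p ^ k ⟨i.val, h⟩ else 1) ?_ ?_ ?_ ?_
  · intro k hk
    simp only [Fintype.mem_piFinset, Finset.mem_range] at hk
    simp only [Finset.mem_filter, Fintype.mem_piFinset, Nat.mem_divisors]
    refine ⟨?_, ?_⟩
    · intro i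
      unfold pcoef
      split_ifs with h
      · exact ⟨pow_dvd_pow _ (by have := hk ⟨i.val, h⟩; simp at this; omega),
          (pow_pos hpp _).ne'⟩
      · simp
    · rw [aux_prod _ _ _ hrn]
      refine pow_dvd_pow _ (le_trans (Finset.sum_le_sum fun j _ => ?_) hK)
      have := hk j; omega
  · intro k hk k' hk' h
    funext j
    have := congrFun h ⟨j.val, by omega⟩
    simpa [Nat.pow_right_injective hp.two_le |>.eq_iff] using this
  · intro c hc
    simp only [Finset.mem_filter, Fintype.mem_piFinset, Nat.mem_divisors] at hc
    have h1 : ∀ j : Fin r, ∃ e ≤ K (j.val + 1), c ⟨j.val, by omega⟩ = p ^ e := by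
      intro j
      have := (hc.1 ⟨j.val, by omega⟩).1
      unfold pcoef at this
      rw [if_pos j.isLt] at this
      exact (Nat.dvd_prime_pow hp).1 this
    choose e he he' using h1
    refine ⟨e, ?_, ?_⟩
    · simp only [Fintype.mem_piFinset, Finset.mem_range]
      intro j; have := he j; omega
    · funext i
      by_cases h : i.val < r
      · simp only [h, dif_pos]; exact (he' ⟨i.val, h⟩).symm
      · simp only [h, dif_neg, not_false_eq_true]
        have := (hc.1 i).1
        unfold pcoef at this
        rw [if_neg h] at this
        exact (Nat.dvd_one.1 this).symm
  · intro k hk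
    simp only [Fintype.mem_piFinset, Finset.mem_range] at hk
    have hs : ∑ j, k j ≤ K 0 := by
      refine (le_trans (Finset.sum_le_sum fun j _ => ?_) hK)
      have := hk j; omega
    congr 1
    funext i
    rw [aux_prod _ _ _ hrn]
    unfold tup pcoef
    beta_reduce
    by_cases h0 : i.val = 0
    · have h1 : i.val < r := by omega
      have h2 : (⟨i.val, h1⟩ : Fin r) = ⟨0, hr⟩ := by ext; exact h0
      have h3 := hk ⟨0, hr⟩
      simp only [zero_add] at h3
      rw [if_pos h0, if_pos h1, if_pos h0, dif_pos h1, h2, h0, Nat.pow_div hs hpp,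
        ← pow_add, Nat.pow_div (by simp only [zero_add]; omega) hpp]
      congr 1
      simp only [zero_add]; omega
    · rw [if_neg h0, if_neg h0]
      by_cases h1 : i.val < r
      · have h3 := hk ⟨i.val, h1⟩
        simp only at h3
        have h4 : i.val - 1 < r := by omega
        rw [dif_pos h1, if_pos h1, dif_pos h4, dif_pos h1, ← pow_add,
          Nat.pow_div (by omega) hpp]
      · rw [dif_neg h1, if_neg h1, dif_neg h1]
        by_cases h2 : i.val = r
        · have h4 : i.val - 1 < r := by omega
          rw [if_pos h2, dif_pos h4]
          simp [h2]
        · have h4 : ¬ i.val - 1 < r := by omega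
          rw [if_neg h2, dif_neg h4]

def aux_mk (s a b : ℕ) (κ : Fin s → ℕ) : Fin (s + 2) → ℕ := fun t =>
  if ht0 : t.val = 0 then a else if ht1 : t.val = 1 then b
    else κ ⟨t.val - 2, by have := t.isLt; omega⟩

theorem aux_split (s : ℕ) (K : ℕ → ℕ) (F : (Fin (s + 2) → ℕ) → ℂ) :
    ∑ k ∈ Fintype.piFinset (fun t : Fin (s + 2) => Finset.range (K (t.val + 1) + 1)), F k
    = ∑ a ∈ Finset.range (K 1 + 1), ∑ b ∈ Finset.range (K 2 + 1),
      ∑ κ ∈ Fintype.piFinset (fun t : Fin s => Finset.range (K (t.val + 3) + 1)),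
        F (aux_mk s a b κ) := by
  have hmk : ∀ k : Fin (s + 2) → ℕ,
      aux_mk s (k 0) (k 1) (fun t => k ⟨t.val + 2, by omega⟩) = k := by
    intro k
    funext t
    unfold aux_mk
    split_ifs with h h'
    · exact congrArg k (Fin.ext (by simp [h]))
    · exact congrArg k (Fin.ext (by simp [h']))
    · exact congrArg k (Fin.ext (by simp only; omega))
  simp_rw [← Finset.sum_product']
  refine Finset.sum_bij'
    (fun k _ => (k 0, k 1, fun t => k ⟨t.val + 2, by omega⟩))
    (fun x _ => aux_mk s x.1 x.2.1 x.2.2) ?_ ?_ ?_ ?_ ?_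
  · intro k hk
    simp only [Fintype.mem_piFinset] at hk
    simp only [Finset.mem_product, Fintype.mem_piFinset]
    exact ⟨hk 0, hk 1, fun t => hk ⟨t.val + 2, by omega⟩⟩
  · rintro ⟨a, b, κ⟩ hx
    simp only [Finset.mem_product, Fintype.mem_piFinset] at hx
    simp only [Fintype.mem_piFinset]
    intro t
    unfold aux_mk
    split_ifs with h h'
    · simpa [h] using hx.1
    · simpa [h'] using hx.2.1
    · have := hx.2.2 ⟨t.val - 2, by omega⟩
      simp only [show t.val - 2 + 3 = t.val + 1 by omega] at this
      exact this
  · intro k hk; exact hmk k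
  · rintro ⟨a, b, κ⟩ hx
    simp [aux_mk]
  · intro k hk
    simp only [hmk]

theorem aux_sum (s a b : ℕ) (κ : Fin s → ℕ) : ∑ j, aux_mk s a b κ j = a + (b + ∑ j, κ j) := by
  rw [Fin.sum_univ_succ, Fin.sum_univ_succ]
  simp [aux_mk]

theorem aux_hecke2 (n : ℕ) (A : (Fin (n - 1) → ℕ) → ℂ) (hA : HeckeRel n A)
    (p : ℕ) (hp : p.Prime) (s : ℕ) (hrn : s + 2 ≤ n - 1)
    (K K' : ℕ → ℕ) (L x y : ℕ) (h1 : K' 1 = x) (h2 : K' 2 = y)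
    (h3 : ∀ j, K' (j + 3) = K (j + 3))
    (hK : x + y + ∑ j : Fin s, K (j.val + 3) ≤ L) :
    A (E n (p ^ L)) * A (pcoef n (s + 2) p K') =
      ∑ a ∈ Finset.range (x + 1), ∑ b ∈ Finset.range (y + 1),
      ∑ κ ∈ Fintype.piFinset (fun t : Fin s => Finset.range (K (t.val + 3) + 1)),
        A (tup n (s + 2) p (by omega) (fun j => if j = 0 then L else if j = 1 then x else
          if j = 2 then y else K j) (aux_mk s a b κ)) := by
  have e : pcoef n (s + 2) p K' = pcoef n (s + 2) p (fun j => if j = 0 then L else if j = 1 then x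
      else if j = 2 then y else K j) := by
    funext i
    unfold pcoef
    congr 2
    obtain ⟨i, hi⟩ := i
    rcases i with _ | _ | i
    · simp [h1]
    · simp [h2]
    · simp [h3]
  rw [e]
  have := aux_hecke n A hA p hp (s + 2) (by omega) hrn (fun j => if j = 0 then L else if j = 1 then x
      else if j = 2 then y else K j) (by
        rw [Fin.sum_univ_succ, Fin.sum_univ_succ]
        have h9 : ∑ j : Fin s, K (j.val + 1 + 1 + 1) = ∑ j : Fin s, K (j.val + 3) := rfl
        simp; omega)
  simp only [if_true] at this
  rw [this, aux_split s (fun j => if j = 0 then L else if j = 1 then x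
      else if j = 2 then y else K j)]
  simp

theorem aux_tup (n p s : ℕ) (K : ℕ → ℕ) (L x y a b L' x' y' a' : ℕ) (κ : Fin s → ℕ)
    (h1 : L + x + 2 * a' = L' + x' + 2 * a) (h2 : y + a = y' + a') :
    tup n (s + 2) p (by omega) (fun j => if j = 0 then L else if j = 1 then x else
          if j = 2 then y else K j) (aux_mk s a b κ)
    = tup n (s + 2) p (by omega) (fun j => if j = 0 then L' else if j = 1 then x' else
          if j = 2 then y' else K j) (aux_mk s a' b κ) := by
  funext i
  obtain ⟨i, hi⟩ := i
  unfold tup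
  simp only [aux_sum]
  rcases i with _ | _ | i
  · simp [aux_mk]; congr 1; omega
  · simp [aux_mk, h2]
  · simp [aux_mk]

theorem statement2 (n : ℕ) (hn : 2 ≤ n) (A : (Fin (n - 1) → ℕ) → ℂ)
    (hA1 : A (fun _ => 1) = 1) (hA : HeckeRel n A)
    (p : ℕ) (hp : p.Prime)
    (r : ℕ) (hr : 2 ≤ r) (hrn : r ≤ n - 1)
    (K : ℕ → ℕ) (hK : ∑ i ∈ Finset.Icc 1 r, K i ≤ K 0)
    (hK1 : 1 ≤ K 1) (hK2 : 1 ≤ K 2) :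
    (A (E n (p ^ K 0)) * A (pcoef n r p K)
        - A (E n (p ^ (K 0 + 1))) * A (pcoef n r p (Function.update K 1 (K 1 - 1))))
      - (A (E n (p ^ (K 0 + 1))) *
            A (pcoef n r p (Function.update (Function.update K 1 (K 1 + 1)) 2 (K 2 - 1)))
          - A (E n (p ^ (K 0 + 2))) * A (pcoef n r p (Function.update K 2 (K 2 - 1)))) =
      ∑ κ ∈ Fintype.piFinset (fun t : Fin (r - 2) => Finset.range (K (t.val + 3) + 1)),
        A (tup n r p (by omega) K
            (fun t => if ht0 : t.val = 0 then K 1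
              else if ht1 : t.val = 1 then K 2
              else κ ⟨t.val - 2, by have := t.isLt; omega⟩)) := by
  obtain ⟨s, rfl⟩ := Nat.exists_eq_add_of_le' hr
  obtain ⟨x, hx⟩ : ∃ x, K 1 = x + 1 := ⟨K 1 - 1, by omega⟩
  obtain ⟨y, hy⟩ : ∃ y, K 2 = y + 1 := ⟨K 2 - 1, by omega⟩
  have hS : x + 1 + (y + 1) + ∑ j : Fin s, K (j.val + 3) ≤ K 0 := by
    refine le_trans (le_of_eq ?_) hK
    rw [← hx, ← hy, Fin.sum_univ_eq_sum_range (fun j => K (j + 3)),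
      ← Finset.Ico_add_one_right_eq_Icc, Finset.sum_Ico_eq_sum_range]
    simp only [Nat.add_sub_cancel]
    rw [Finset.sum_range_succ', Finset.sum_range_succ']
    simp only [show ∀ j, 1 + (j + 1 + 1) = j + 3 by intro j; omega]
    simp; omega
  rw [aux_hecke2 n A hA p hp s hrn K K (K 0) (x + 1) (y + 1) hx hy (fun _ => rfl) hS,
    aux_hecke2 n A hA p hp s hrn K _ (K 0 + 1) x (y + 1) (by simp [hx]) (by simp [hy])
      (by intro j; simp) (by omega),
    aux_hecke2 n A hA p hp s hrn K _ (K 0 + 1) (x + 2) y (by simp [hx]) (by simp [hy])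
      (by intro j; simp) (by omega),
    aux_hecke2 n A hA p hp s hrn K _ (K 0 + 2) (x + 1) y (by simp [hx]) (by simp [hy])
      (by intro j; simp) (by omega)]
  have t1 := fun a b κ => aux_tup n p s K (K 0 + 1) x (y + 1) a b (K 0) (x + 1) (y + 1) a κ
    (by omega) rfl
  have t2 := fun a b κ => aux_tup n p s K (K 0 + 2) (x + 1) y a b (K 0 + 1) (x + 2) y a κ
    (by omega) rfl
  have t3 := fun b κ => aux_tup n p s K (K 0 + 1) (x + 2) y (x + 2) b (K 0) (x + 1) (y + 1)
    (x + 1) κ (by omega) (by omega)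
  simp only [t1, t2]
  rw [Finset.sum_range_succ _ (x + 1), Finset.sum_range_succ _ (x + 2), add_sub_cancel_left,
    add_sub_cancel_left]
  simp only [t3]
  rw [Finset.sum_range_succ _ (y + 1), add_sub_cancel_left]
  refine Finset.sum_congr rfl fun κ _ => ?_
  have e : (fun j => if j = 0 then K 0 else if j = 1 then x + 1 else
          if j = 2 then y + 1 else K j) = K := by
    funext j
    split_ifs with h h h <;> simp_all
  rw [e, ← hx, ← hy]
  rfl
end

section
/- Suppose n ≥ 3. Let p be a prime and j ∈ ℤ_{≥1}. Then A(p^{j−1}, 1, …, 1) · A(p^{j+1}, 1, …, 1) = Σ_{k=0}^{j−1} A(p^{2j−2k}, p^k, 1, …, 1). -/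
theorem prodE (n : ℕ) (hn : 3 ≤ n) (m : ℕ) : ∏ i, E n m i = m := by
  rw [Finset.prod_eq_single (⟨0, by omega⟩ : Fin (n - 1))]
  · simp [E]
  · intro b _ hb
    have : b.val ≠ 0 := fun h => hb (Fin.ext h)
    simp [E, this]
  · simp

/-- Equation (4.3):  Suppose `n ≥ 3`.  Let `p` be a prime and `j ∈ ℤ_{≥1}`.  Then
`A(p^{j-1},1,…,1)·A(p^{j+1},1,…,1) = Σ_{k=0}^{j-1} A(p^{2j-2k}, p^k, 1, …, 1)`. -/
theorem statement16 (n : ℕ) (hn : 3 ≤ n) (A : (Fin (n - 1) → ℕ) → ℂ)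
    (hA1 : A (fun _ => 1) = 1) (hA : HeckeRel n A)
    (p : ℕ) (hp : p.Prime) (j : ℕ) (hj : 1 ≤ j) :
    A (E n (p ^ (j - 1))) * A (E n (p ^ (j + 1))) =
      ∑ k ∈ Finset.range j,
        A (fun i => if i.val = 0 then p ^ (2 * j - 2 * k)
            else if i.val = 1 then p ^ k else 1) := by
  have hpp := hp.pos
  rw [hA (p ^ (j - 1)) (pow_pos hpp _) (E n (p ^ (j + 1)))
    (by intro i; unfold E; split_ifs; exacts [pow_pos hpp _, Nat.one_pos])]
  symm
  refine Finset.sum_bij (fun k _ => E n (p ^ k)) ?_ ?_ ?_ ?_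
  · intro k hk
    rw [Finset.mem_range] at hk
    rw [Finset.mem_filter, Fintype.mem_piFinset, prodE n hn]
    refine ⟨fun i => ?_, pow_dvd_pow p (by omega)⟩
    by_cases hi : i.val = 0
    · simp only [E, hi, if_true, Nat.mem_divisors]
      exact ⟨pow_dvd_pow p (by omega), (pow_pos hpp _).ne'⟩
    · simp [E, hi]
  · intro a _ b _ hab
    have := congrFun hab (⟨0, by omega⟩ : Fin (n - 1))
    simp only [E, if_true] at this
    exact Nat.pow_right_injective hp.two_le this
  · intro c hc
    rw [Finset.mem_filter, Fintype.mem_piFinset] at hc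
    obtain ⟨h1, h2⟩ := hc
    have hcE : c = E n (c ⟨0, by omega⟩) := by
      funext i
      by_cases hi : i.val = 0
      · simp only [E, hi, if_true]
        exact congrArg c (Fin.ext hi)
      · have := h1 i
        simp only [E, hi, if_false, Nat.divisors_one, Finset.mem_singleton] at this ⊢
        exact this
    rw [hcE, prodE n hn] at h2
    obtain ⟨k, hk, hk2⟩ := (Nat.dvd_prime_pow hp).1 h2
    refine ⟨k, Finset.mem_range.2 (by omega), ?_⟩
    rw [hcE, hk2]
  · intro k hk
    rw [Finset.mem_range] at hk
    congr 1
    funext i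
    rw [prodE n hn]
    by_cases hi : i.val = 0
    · simp only [E, hi, if_true]
      rw [Nat.pow_div (by omega) hpp, ← pow_add, Nat.pow_div (by omega) hpp]
      congr 1
      omega
    · by_cases h1 : i.val = 1
      · simp [E, h1]
      · have : i.val - 1 ≠ 0 := by omega
        simp [E, hi, h1, this]
end
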